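/- arXiv:0911.3114 — 14 statements merged into one kernel-verified Lean document; each statement's English description precedes it below -/
import Mathlib

section
/- For all s, t, r ∈ M, the cocycle identity τ(s,t) τ(s·t, r) = (s▷τ(t,r)) τ(s◁τ(t,r), t·r) holds in G. -/
theorem stmt_0 (X : Type*) [Group X] (G : Subgroup X) (M : Set X)
    (h1 : (1 : X) ∈ M)
    (hM : ∀ x : X, ∃! s : M, ∃ g : G, x = (g : X) * (s : X))
    (tau : M → M → G) (mul : M → M → M)
    (htau : ∀ s t : M, (s : X) * (t : X) = (tau s t : X) * (mul s t : X))
    (tri : M → G → G) (lt : M → G → M)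
    (htl : ∀ (s : M) (u : G), (s : X) * (u : X) = (tri s u : X) * (lt s u : X))
: ∀ s t r : M,
    tau s t * tau (mul s t) r
      = tri s (tau t r) * tau (lt s (tau t r)) (mul t r) := by
  intro s t r
  have hl : (s : X) * t * r = ((tau s t * tau (mul s t) r : G) : X) * (mul (mul s t) r : X) := by
    rw [htau s t, mul_assoc, htau (mul s t) r, Subgroup.coe_mul, mul_assoc]
  have hr : (s : X) * t * r = ((tri s (tau t r) * tau (lt s (tau t r)) (mul t r) : G) : X) *
      (mul (lt s (tau t r)) (mul t r) : X) := by
    rw [mul_assoc, htau t r, ← mul_assoc, htl s (tau t r), mul_assoc, htau, Subgroup.coe_mul,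
      mul_assoc]
  have heq : mul (mul s t) r = mul (lt s (tau t r)) (mul t r) :=
    (hM ((s : X) * t * r)).unique ⟨_, hl⟩ ⟨_, hr⟩
  rw [← heq] at hr
  exact Subtype.ext (mul_right_cancel (hl.symm.trans hr))
end

section
/- For all s, t ∈ M and u ∈ G, one has (s·t)◁u = (s◁(t▷u))·(t◁u). -/
theorem stmt_2 (X : Type*) [Group X] (G : Subgroup X) (M : Set X)
    (h1 : (1 : X) ∈ M)
    (hM : ∀ x : X, ∃! s : M, ∃ g : G, x = (g : X) * (s : X))
    (tau : M → M → G) (mul : M → M → M)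
    (htau : ∀ s t : M, (s : X) * (t : X) = (tau s t : X) * (mul s t : X))
    (tri : M → G → G) (lt : M → G → M)
    (htl : ∀ (s : M) (u : G), (s : X) * (u : X) = (tri s u : X) * (lt s u : X))
: ∀ (s t : M) (u : G),
    lt (mul s t) u = mul (lt s (tri t u)) (lt t u) := by
  intro s t u
  refine (hM (s * t * u)).unique
    ⟨tau s t * tri (mul s t) u, ?_⟩
    ⟨tri s (tri t u) * tau (lt s (tri t u)) (lt t u), ?_⟩
  · rw [htau, mul_assoc, htl, Subgroup.coe_mul, mul_assoc]
  · rw [mul_assoc, htl t u, ← mul_assoc, htl s (tri t u), mul_assoc, htau, Subgroup.coe_mul,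
      mul_assoc]
end

section
/- For every s ∈ M there is a unique element s^{-L} ∈ M such that s^{-1} = τ(s^{-L},s)^{-1} s^{-L} in X, and this element satisfies: (a) s^{-L}·s = 1; (b) (s◁τ(s^{-L},s)^{-1})·s^{-L} = 1; and (c) s▷τ(s^{-L},s)^{-1} = τ(s◁τ(s^{-L},s)^{-1}, s^{-L})^{-1}. -/
/-- Factorizations through a transversal of a subgroup are unique. -/
theorem transversal_factorization_unique {X : Type*} [Group X] {G : Subgroup X} {M : Set X}
    (hM : ∀ x : X, ∃! s : M, ∃ g : G, x = (g : X) * (s : X))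
    {g h : G} {s t : M} (e : (g : X) * (s : X) = (h : X) * (t : X)) : g = h ∧ s = t := by
  obtain rfl : s = t := (hM ((g : X) * s)).unique ⟨g, rfl⟩ ⟨h, e⟩
  exact ⟨Subtype.ext (mul_right_cancel e), rfl⟩


theorem stmt_6 (X : Type*) [Group X] (G : Subgroup X) (M : Set X)
    (h1 : (1 : X) ∈ M)
    (hM : ∀ x : X, ∃! s : M, ∃ g : G, x = (g : X) * (s : X))
    (tau : M → M → G) (mul : M → M → M)
    (htau : ∀ s t : M, (s : X) * (t : X) = (tau s t : X) * (mul s t : X))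
    (tri : M → G → G) (lt : M → G → M)
    (htl : ∀ (s : M) (u : G), (s : X) * (u : X) = (tri s u : X) * (lt s u : X))
: ∀ s : M,
    (∃! sl : M, (s : X)⁻¹ = ((tau sl s : G) : X)⁻¹ * (sl : X)) ∧
    (∀ sl : M, (s : X)⁻¹ = ((tau sl s : G) : X)⁻¹ * (sl : X) →
      ((mul sl s : M) : X) = 1 ∧
      ((mul (lt s ((tau sl s)⁻¹)) sl : M) : X) = 1 ∧
      tri s ((tau sl s)⁻¹) = (tau (lt s ((tau sl s)⁻¹)) sl)⁻¹) := by
  intro s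
  have factor_of_mem {a b : M} {g : G} (e : (a : X) * b = g) :
      tau a b = g ∧ (mul a b : X) = 1 := by
    have := transversal_factorization_unique hM (g := tau a b) (h := g) (s := mul a b)
      (t := ⟨1, h1⟩) (by rw [← htau, e, mul_one])
    exact ⟨this.1, congrArg Subtype.val this.2⟩
  refine ⟨?_, fun sl hsl => ?_⟩
  · obtain ⟨sl, ⟨g, hg⟩, -⟩ := hM (s : X)⁻¹
    have e : (sl : X) * s = (g⁻¹ : G) := by
      rw [← inv_inv (s : X), hg]
      simp
    refine ⟨sl, ?_, fun t ht => ?_⟩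
    · simp only [(factor_of_mem e).1, InvMemClass.coe_inv, inv_inv, hg]
    · refine (transversal_factorization_unique hM (g := (tau t s)⁻¹) (h := g) ?_).2
      rw [← hg, ht, InvMemClass.coe_inv]
  · have e : (sl : X) * s = tau sl s := by
      rw [← inv_inv (s : X), hsl]
      simp
    have e' : (lt s (tau sl s)⁻¹ : X) * sl = ((tri s (tau sl s)⁻¹)⁻¹ : G) := by
      have h := htl s (tau sl s)⁻¹
      rw [InvMemClass.coe_inv, ← e, mul_inv_rev, mul_inv_cancel_left] at h
      refine eq_inv_of_mul_eq_one_right ?_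
      rw [← mul_assoc, ← h, inv_mul_cancel]
    exact ⟨(factor_of_mem e).2, (factor_of_mem e').2, by rw [(factor_of_mem e').1, inv_inv]⟩
end

section
/- M with the product · is a right quasigroup with identity: defining t/s = (t◁τ(s^{-L},s)^{-1})·s^{-L}, one has (t/s)·s = t and (t·s)/s = t for all s, t ∈ M. In particular right cancellation holds: t·s = t'·s implies t = t'. -/
/-- Elements of a left transversal lying in the same coset of the subgroup coincide. -/
theorem transversal_eq_of_mul_eq {X : Type*} [Group X] {G : Subgroup X} {M : Set X}
    (hM : ∀ x : X, ∃! s : M, ∃ g : G, x = (g : X) * (s : X))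
    {s t : M} (g : G) (h : (s : X) = (g : X) * (t : X)) : s = t :=
  (hM (s : X)).unique ⟨1, by simp⟩ ⟨g, h⟩

theorem stmt_7 (X : Type*) [Group X] (G : Subgroup X) (M : Set X)
    (h1 : (1 : X) ∈ M)
    (hM : ∀ x : X, ∃! s : M, ∃ g : G, x = (g : X) * (s : X))
    (tau : M → M → G) (mul : M → M → M)
    (htau : ∀ s t : M, (s : X) * (t : X) = (tau s t : X) * (mul s t : X))
    (tri : M → G → G) (lt : M → G → M)
    (htl : ∀ (s : M) (u : G), (s : X) * (u : X) = (tri s u : X) * (lt s u : X))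
    (inv : M → M)
    (hinv : ∀ s : M, (s : X)⁻¹ = ((tau (inv s) s : G) : X)⁻¹ * ((inv s : M) : X))
: (∀ s t : M,
      mul (mul (lt t ((tau (inv s) s)⁻¹)) (inv s)) s = t ∧
      mul (lt (mul t s) ((tau (inv s) s)⁻¹)) (inv s) = t) ∧
    (∀ s t t' : M, mul t s = mul t' s → t = t') := by
  have hdiv : ∀ s t : M, ∃ g : G,
      (mul (lt t (tau (inv s) s)⁻¹) (inv s) : X) = (g : X) * (t * (s : X)⁻¹) := by
    intro s t
    have hmul := htau (lt t (tau (inv s) s)⁻¹) (inv s)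
    have hact := htl t (tau (inv s) s)⁻¹
    rw [← inv_mul_eq_iff_eq_mul] at hmul hact
    refine ⟨(tau (lt t (tau (inv s) s)⁻¹) (inv s))⁻¹ * (tri t (tau (inv s) s)⁻¹)⁻¹, ?_⟩
    rw [← hmul, ← hact, hinv s]
    simp [mul_assoc]
  have hleft : ∀ s t : M, mul (mul (lt t (tau (inv s) s)⁻¹) (inv s)) s = t := by
    intro s t
    obtain ⟨g, hg⟩ := hdiv s t
    have hmul := htau (mul (lt t (tau (inv s) s)⁻¹) (inv s)) s
    rw [← inv_mul_eq_iff_eq_mul, hg] at hmul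
    refine transversal_eq_of_mul_eq hM
      ((tau (mul (lt t (tau (inv s) s)⁻¹) (inv s)) s)⁻¹ * g) ?_
    rw [← hmul]
    simp [mul_assoc]
  have hright : ∀ s t : M, mul (lt (mul t s) (tau (inv s) s)⁻¹) (inv s) = t := by
    intro s t
    obtain ⟨g, hg⟩ := hdiv s (mul t s)
    have hmul := htau t s
    rw [← inv_mul_eq_iff_eq_mul] at hmul
    refine transversal_eq_of_mul_eq hM (g * (tau t s)⁻¹) ?_
    rw [hg, ← hmul]
    simp [mul_assoc]
  refine ⟨fun s t => ⟨hleft s t, hright s t⟩, fun s t t' h => ?_⟩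
  rw [← hright s t, h, hright s t']
end

section
/- For all t ∈ M and v ∈ G, one has (t◁v)^{-L} = t^{-L}◁(t▷v) in M. -/
theorem stmt_10 (X : Type*) [Group X] (G : Subgroup X) (M : Set X)
    (h1 : (1 : X) ∈ M)
    (hM : ∀ x : X, ∃! s : M, ∃ g : G, x = (g : X) * (s : X))
    (tau : M → M → G) (mul : M → M → M)
    (htau : ∀ s t : M, (s : X) * (t : X) = (tau s t : X) * (mul s t : X))
    (tri : M → G → G) (lt : M → G → M)
    (htl : ∀ (s : M) (u : G), (s : X) * (u : X) = (tri s u : X) * (lt s u : X))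
    (inv : M → M)
    (hinv : ∀ s : M, (s : X)⁻¹ = ((tau (inv s) s : G) : X)⁻¹ * ((inv s : M) : X))
: ∀ (t : M) (v : G), inv (lt t v) = lt (inv t) (tri t v) := by
  intro t v
  have hlt : (lt t v : X) = (tri t v : X)⁻¹ * ((t : X) * (v : X)) := by
    rw [htl t v, inv_mul_cancel_left]
  refine (hM (lt t v : X)⁻¹).unique ⟨(tau (inv (lt t v)) (lt t v))⁻¹, hinv _⟩
    ⟨v⁻¹ * (tau (inv t) t)⁻¹ * tri (inv t) (tri t v), ?_⟩
  calc (lt t v : X)⁻¹ = (v : X)⁻¹ * (t : X)⁻¹ * (tri t v : X) := by rw [hlt]; group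
    _ = (v : X)⁻¹ * (tau (inv t) t : X)⁻¹ * ((inv t : X) * (tri t v : X)) := by
      rw [hinv t]; group
    _ = _ := by rw [htl (inv t) (tri t v)]; push_cast; group
end

section
/- The map φ : G × M → X given by φ(u,s) = us is a bijection, and under it the group structure of X is given by the double cross product formulas: φ(u,s)φ(v,t) = φ(u(s▷v)τ(s◁v,t), (s◁v)·t) and φ(u,s)^{-1} = φ(τ(s^{-L},s)^{-1}(s^{-L}▷u^{-1}), s^{-L}◁u^{-1}) for all u, v ∈ G and s, t ∈ M. -/
theorem stmt_11 (X : Type*) [Group X] (G : Subgroup X) (M : Set X)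
    (h1 : (1 : X) ∈ M)
    (hM : ∀ x : X, ∃! s : M, ∃ g : G, x = (g : X) * (s : X))
    (tau : M → M → G) (mul : M → M → M)
    (htau : ∀ s t : M, (s : X) * (t : X) = (tau s t : X) * (mul s t : X))
    (tri : M → G → G) (lt : M → G → M)
    (htl : ∀ (s : M) (u : G), (s : X) * (u : X) = (tri s u : X) * (lt s u : X))
    (inv : M → M)
    (hinv : ∀ s : M, (s : X)⁻¹ = ((tau (inv s) s : G) : X)⁻¹ * ((inv s : M) : X))
: Function.Bijective (fun p : G × M => ((p.1 : X) * (p.2 : X))) ∧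
    (∀ (u v : G) (s t : M),
      ((u : X) * (s : X)) * ((v : X) * (t : X))
        = ((u * tri s v * tau (lt s v) t : G) : X) * ((mul (lt s v) t : M) : X)) ∧
    (∀ (u : G) (s : M),
      ((u : X) * (s : X))⁻¹
        = (((tau (inv s) s)⁻¹ * tri (inv s) u⁻¹ : G) : X) * ((lt (inv s) u⁻¹ : M) : X)) := by
  refine ⟨⟨?_, ?_⟩, ?_, ?_⟩
  · rintro ⟨u, s⟩ ⟨v, t⟩ h
    have h' : (u : X) * s = v * t := h
    obtain rfl : s = t := (hM ((u : X) * s)).unique ⟨u, rfl⟩ ⟨v, h'⟩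
    obtain rfl : u = v := Subtype.ext (mul_right_cancel h')
    rfl
  · intro x
    obtain ⟨s, ⟨g, hg⟩, -⟩ := hM x
    exact ⟨(g, s), hg.symm⟩
  · intro u v s t
    calc ((u : X) * s) * (v * t) = u * (s * v) * t := by group
      _ = u * tri s v * (lt s v * t) := by rw [htl]; group
      _ = _ := by rw [htau]; push_cast; group
  · intro u s
    have h := htl (inv s) u⁻¹
    push_cast at h ⊢
    rw [mul_inv_rev, hinv, mul_assoc, h, mul_assoc]
end

section
/- If s ∈ M has a right inverse, i.e. there is s^{-R} ∈ M with s·s^{-R} = 1, then s^{-L}▷τ(s,s^{-R}) = τ(s^{-L},s) and s^{-L}◁τ(s,s^{-R}) = s^{-R}. -/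
theorem stmt_12 (X : Type*) [Group X] (G : Subgroup X) (M : Set X)
    (h1 : (1 : X) ∈ M)
    (hM : ∀ x : X, ∃! s : M, ∃ g : G, x = (g : X) * (s : X))
    (tau : M → M → G) (mul : M → M → M)
    (htau : ∀ s t : M, (s : X) * (t : X) = (tau s t : X) * (mul s t : X))
    (tri : M → G → G) (lt : M → G → M)
    (htl : ∀ (s : M) (u : G), (s : X) * (u : X) = (tri s u : X) * (lt s u : X))
    (inv : M → M)
    (hinv : ∀ s : M, (s : X)⁻¹ = ((tau (inv s) s : G) : X)⁻¹ * ((inv s : M) : X))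
: ∀ s sr : M, ((mul s sr : M) : X) = 1 →
    tri (inv s) (tau s sr) = tau (inv s) s ∧ lt (inv s) (tau s sr) = sr := by
  intro s sr hs
  have hprod : (s : X) * (sr : X) = (tau s sr : X) := by
    rw [htau, hs, mul_one]
  have hleft : (inv s : X) = (tau (inv s) s : X) * (s : X)⁻¹ := by
    rw [hinv s, mul_inv_cancel_left]
  have hfactor : (inv s : X) * (tau s sr : X) = (tau (inv s) s : X) * (sr : X) := by
    rw [← hprod, hleft, mul_assoc, inv_mul_cancel_left]
  have hlt : lt (inv s) (tau s sr) = sr :=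
    (hM ((inv s : X) * (tau s sr : X))).unique ⟨_, htl _ _⟩ ⟨_, hfactor⟩
  refine ⟨Subtype.ext (mul_right_cancel (b := (sr : X)) ?_), hlt⟩
  rw [← hfactor, htl, hlt]
end

section
/- The following are equivalent: (i) for every s ∈ M, the set {s▷u : u ∈ G} equals G; (ii) every s ∈ M has a right inverse, i.e. there exists s^{-R} ∈ M with s·s^{-R} = 1; (iii) X = MG, i.e. every x ∈ X can be written as x = sv with s ∈ M and v ∈ G. -/
theorem stmt_13 (X : Type*) [Group X] (G : Subgroup X) (M : Set X)
    (h1 : (1 : X) ∈ M)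
    (hM : ∀ x : X, ∃! s : M, ∃ g : G, x = (g : X) * (s : X))
    (tau : M → M → G) (mul : M → M → M)
    (htau : ∀ s t : M, (s : X) * (t : X) = (tau s t : X) * (mul s t : X))
    (tri : M → G → G) (lt : M → G → M)
    (htl : ∀ (s : M) (u : G), (s : X) * (u : X) = (tri s u : X) * (lt s u : X))
: ((∀ s : M, Function.Surjective (tri s)) ↔
      (∀ s : M, ∃ sr : M, ((mul s sr : M) : X) = 1)) ∧
    ((∀ s : M, ∃ sr : M, ((mul s sr : M) : X) = 1) ↔
      (∀ x : X, ∃ (s : M) (v : G), x = (s : X) * (v : X))) := by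
  have huniq : ∀ (g g' : G) (s s' : M), (g : X) * (s : X) = (g' : X) * (s' : X) →
      g = g' ∧ s = s' := by
    intro g g' s s' h
    obtain rfl : s = s' := (hM ((g : X) * (s : X))).unique ⟨g, rfl⟩ ⟨g', h⟩
    exact ⟨Subtype.ext (mul_right_cancel h), rfl⟩
  have h_tri_iff : (∀ s : M, Function.Surjective (tri s)) ↔
      (∀ x : X, ∃ (s : M) (v : G), x = (s : X) * (v : X)) := by
    constructor
    · intro h x
      obtain ⟨s, ⟨g, hx⟩, -⟩ := hM x
      obtain ⟨u, hu⟩ := h s g⁻¹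
      refine ⟨lt s u, u⁻¹, ?_⟩
      have e := htl s u
      rw [hu, Subgroup.coe_inv, eq_inv_mul_iff_mul_eq] at e
      rw [← e, hx, Subgroup.coe_inv]
      group
    · intro h s g
      obtain ⟨t, v, htv⟩ := h ((g : X)⁻¹ * s)
      refine ⟨v⁻¹, (huniq _ _ (lt s v⁻¹) t ?_).1⟩
      rw [← htl, Subgroup.coe_inv, mul_inv_eq_iff_eq_mul, mul_assoc, ← htv, mul_inv_cancel_left]
  have h_mul_iff : (∀ s : M, ∃ sr : M, ((mul s sr : M) : X) = 1) ↔
      (∀ x : X, ∃ (s : M) (v : G), x = (s : X) * (v : X)) := by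
    constructor
    · intro h x
      obtain ⟨s, ⟨g, hx⟩, -⟩ := hM x⁻¹
      obtain ⟨t, ht⟩ := h s
      have e := htau s t
      rw [ht, mul_one] at e
      refine ⟨t, (tau s t)⁻¹ * g⁻¹, ?_⟩
      rw [Subgroup.coe_mul, Subgroup.coe_inv, Subgroup.coe_inv, ← e, ← inv_inv x, hx]
      group
    · intro h s
      obtain ⟨t, v, htv⟩ := h (s : X)⁻¹
      refine ⟨t, congrArg Subtype.val (huniq (tau s t) v⁻¹ (mul s t) ⟨1, h1⟩ ?_).2⟩
      rw [← htau, mul_one, Subgroup.coe_inv, eq_inv_iff_mul_eq_one, mul_assoc, ← htv,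
        mul_inv_cancel]
  exact ⟨h_tri_iff.trans h_mul_iff.symm, h_mul_iff⟩
end

section
/- M with the product · is a two-sided inverse property quasigroup (i.e. s^{-L}·(s·t) = t and (t·s)·s^{-L} = t for all s, t ∈ M) if and only if t = t◁τ(s^{-L},s) and s^{-L} = s^{-L}◁τ(s,t) hold for all s, t ∈ M; and in that case (s^{-L})^{-L} = s for all s ∈ M. -/
theorem stmt_14 (X : Type*) [Group X] (G : Subgroup X) (M : Set X)
    (h1 : (1 : X) ∈ M)
    (hM : ∀ x : X, ∃! s : M, ∃ g : G, x = (g : X) * (s : X))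
    (tau : M → M → G) (mul : M → M → M)
    (htau : ∀ s t : M, (s : X) * (t : X) = (tau s t : X) * (mul s t : X))
    (tri : M → G → G) (lt : M → G → M)
    (htl : ∀ (s : M) (u : G), (s : X) * (u : X) = (tri s u : X) * (lt s u : X))
    (inv : M → M)
    (hinv : ∀ s : M, (s : X)⁻¹ = ((tau (inv s) s : G) : X)⁻¹ * ((inv s : M) : X))
: ((∀ s t : M, mul (inv s) (mul s t) = t ∧ mul (mul t s) (inv s) = t) ↔
      (∀ s t : M, t = lt t (tau (inv s) s) ∧ inv s = lt (inv s) (tau s t))) ∧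
    ((∀ s t : M, mul (inv s) (mul s t) = t ∧ mul (mul t s) (inv s) = t) →
      ∀ s : M, inv (inv s) = s) := by
  have huniq : ∀ (g h : G) (s t : M), (g : X) * (s : X) = (h : X) * (t : X) → s = t :=
    fun g h s t e => (hM _).unique ⟨g, rfl⟩ ⟨h, e⟩
  have hassoc : ∀ s t u : M, mul (mul s t) u = mul (lt s (tau t u)) (mul t u) := by
    intro s t u
    apply huniq (tau s t * tau (mul s t) u)
      (tri s (tau t u) * tau (lt s (tau t u)) (mul t u))
    rw [Subgroup.coe_mul, Subgroup.coe_mul, mul_assoc, ← htau (mul s t) u, ← mul_assoc,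
      ← htau s t, mul_assoc (tri s (tau t u) : X), ← htau, ← mul_assoc, ← htl, mul_assoc,
      mul_assoc, ← htau]
  have hcancel : ∀ s t u : M, mul s u = mul t u → s = t := by
    intro s t u e
    apply huniq (tau s u)⁻¹ (tau t u)⁻¹
    apply mul_right_cancel (b := (u : X))
    rw [mul_assoc, mul_assoc, htau, htau, e]
    simp
  have hone_mul : ∀ t : M, mul ⟨1, h1⟩ t = t := by
    intro t
    apply huniq (tau ⟨1, h1⟩ t) 1
    rw [← htau]
    simp
  have hmul_one : ∀ t : M, mul t ⟨1, h1⟩ = t := by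
    intro t
    apply huniq (tau t ⟨1, h1⟩) 1
    rw [← htau]
    simp
  have hinv_mul : ∀ s : M, mul (inv s) s = ⟨1, h1⟩ := by
    intro s
    apply huniq (tau (inv s) s) (tau (inv s) s)
    have h : (tau (inv s) s : X) = (inv s : X) * s := by
      apply eq_mul_of_mul_inv_eq
      rw [hinv, mul_inv_cancel_left]
    rw [← htau, ← h]
    simp
  have hleft : ∀ s t : M, mul (inv s) (mul s t) = t ↔ inv s = lt (inv s) (tau s t) := by
    intro s t
    have h := hassoc (inv s) s t
    rw [hinv_mul, hone_mul] at h
    constructor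
    · intro e
      exact hcancel _ _ (mul s t) (e.trans h)
    · intro e
      rw [← e] at h
      exact h.symm
  have hinv_inv : (∀ s t : M, mul (inv s) (mul s t) = t) → ∀ s : M, inv (inv s) = s := by
    intro h s
    have e := h (inv s) s
    rwa [hinv_mul, hmul_one] at e
  have hright : ∀ s t : M, mul (mul t (inv s)) s = lt t (tau (inv s) s) := by
    intro s t
    rw [hassoc, hinv_mul, hmul_one]
  refine ⟨⟨fun h s t => ⟨?_, (hleft s t).mp (h s t).1⟩,
    fun h s t => ⟨(hleft s t).mpr (h s t).2, ?_⟩⟩, fun h => hinv_inv fun s t => (h s t).1⟩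
  · have e := (h (inv s) t).2
    rw [hinv_inv (fun s t => (h s t).1), hright] at e
    exact e.symm
  · have hi := hinv_inv fun s t => (hleft s t).mpr (h s t).2
    have e := hright (inv s) t
    rw [hi] at e
    rw [e]
    have e' := (h (inv s) t).1
    rw [hi] at e'
    exact e'.symm
end

section
/- For s ∈ M and u ∈ G, the identity (s◁u)^{-L}▷(s▷u)^{-1} = u^{-1} holds if and only if u^{-1}τ(s^{-L},s)u = τ(s^{-L}◁(s▷u), s◁u). -/
theorem stmt_15 (X : Type*) [Group X] (G : Subgroup X) (M : Set X)
    (h1 : (1 : X) ∈ M)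
    (hM : ∀ x : X, ∃! s : M, ∃ g : G, x = (g : X) * (s : X))
    (tau : M → M → G) (mul : M → M → M)
    (htau : ∀ s t : M, (s : X) * (t : X) = (tau s t : X) * (mul s t : X))
    (tri : M → G → G) (lt : M → G → M)
    (htl : ∀ (s : M) (u : G), (s : X) * (u : X) = (tri s u : X) * (lt s u : X))
    (inv : M → M)
    (hinv : ∀ s : M, (s : X)⁻¹ = ((tau (inv s) s : G) : X)⁻¹ * ((inv s : M) : X))
: ∀ (s : M) (u : G),
    tri (inv (lt s u)) ((tri s u)⁻¹) = u⁻¹ ↔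
      u⁻¹ * tau (inv s) s * u = tau (lt (inv s) (tri s u)) (lt s u) := by
  intro s u
  have inv_mul (t : M) : (inv t : X) * (t : X) = (tau (inv t) t : X) := by
    have h := hinv t
    rw [eq_inv_mul_iff_mul_eq] at h
    rw [← h, inv_mul_cancel_right]
  set p := tri s u
  set q := lt s u
  set a := tri (inv s) p
  set r := lt (inv s) p
  have hsu : (s : X) * (u : X) = (p : X) * (q : X) := htl s u
  have hsp : (inv s : X) * (p : X) = (a : X) * (r : X) := htl (inv s) p
  have hrq : (r : X) * (q : X) = ((a⁻¹ * tau (inv s) s * u : G) : X) := by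
    push_cast
    rw [← inv_mul s, mul_assoc, mul_assoc, hsu, eq_inv_mul_iff_mul_eq, ← mul_assoc, ← hsp,
      mul_assoc]
  have htau_rq : tau r q = a⁻¹ * tau (inv s) s * u := by
    refine (transversal_factorization_unique hM (s := mul r q) (t := ⟨1, h1⟩) ?_).1
    rw [← htau, hrq, mul_one]
  have hr : r = inv q := by
    refine (transversal_factorization_unique hM (g := 1)
      (h := a⁻¹ * tau (inv s) s * u * (tau (inv q) q)⁻¹) ?_).2
    rw [Subgroup.coe_mul, Subgroup.coe_inv, mul_assoc, ← hinv, ← hrq]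
    simp
  have htri : tri (inv q) p⁻¹ = a⁻¹ := by
    refine (transversal_factorization_unique hM (s := lt (inv q) p⁻¹) (t := inv s) ?_).1
    rw [← htl, ← hr, Subgroup.coe_inv, Subgroup.coe_inv, mul_inv_eq_iff_eq_mul, mul_assoc, hsp,
      inv_mul_cancel_left]
  rw [htri, htau_rq, mul_left_inj, mul_left_inj, eq_comm]
end

section
/- For all s ∈ M and u ∈ G, one has (s◁u)^{-L}◁(s▷u)^{-1} = s^{-L}. -/
theorem stmt_16 (X : Type*) [Group X] (G : Subgroup X) (M : Set X)
    (h1 : (1 : X) ∈ M)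
    (hM : ∀ x : X, ∃! s : M, ∃ g : G, x = (g : X) * (s : X))
    (tau : M → M → G) (mul : M → M → M)
    (htau : ∀ s t : M, (s : X) * (t : X) = (tau s t : X) * (mul s t : X))
    (tri : M → G → G) (lt : M → G → M)
    (htl : ∀ (s : M) (u : G), (s : X) * (u : X) = (tri s u : X) * (lt s u : X))
    (inv : M → M)
    (hinv : ∀ s : M, (s : X)⁻¹ = ((tau (inv s) s : G) : X)⁻¹ * ((inv s : M) : X))
: ∀ (s : M) (u : G),
    lt (inv (lt s u)) ((tri s u)⁻¹) = inv s := by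
  intro s u
  refine (hM (s : X)⁻¹).unique
    ⟨u * (tau (inv (lt s u)) (lt s u))⁻¹ * tri (inv (lt s u)) (tri s u)⁻¹, ?_⟩
    ⟨(tau (inv s) s)⁻¹, by simpa using hinv s⟩
  have h_inv_mul := htl (inv (lt s u)) (tri s u)⁻¹
  have hs : (s : X)⁻¹ = u * ((lt s u : X)⁻¹ * (tri s u : X)⁻¹) := by
    rw [← mul_inv_rev, ← htl s u]
    group
  rw [hs, hinv (lt s u)]
  push_cast at h_inv_mul ⊢
  simp only [mul_assoc]
  rw [h_inv_mul]
end

section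
/- For all s, t ∈ M and u ∈ G, the identity (s·t)▷u = s▷(t▷u) holds if and only if τ(s◁(t▷u), t◁u) = (s▷(t▷u))^{-1} τ(s,t) (s▷(t▷u)). (This condition on τ, together with M being a two-sided inverse property quasigroup, is the condition for the bicrossproduct kM⋈k(G) to be a Hopf quasigroup.) -/
/-- The cocycle relation obtained by factoring `s * t * u` in two ways. -/
theorem cocycle_mul_action_eq {X : Type*} [Group X] {G : Subgroup X} {M : Set X}
    (hM : ∀ x : X, ∃! s : M, ∃ g : G, x = (g : X) * (s : X))
    {tau : M → M → G} {mul : M → M → M}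
    (htau : ∀ s t : M, (s : X) * (t : X) = (tau s t : X) * (mul s t : X))
    {tri : M → G → G} {lt : M → G → M}
    (htl : ∀ (s : M) (u : G), (s : X) * (u : X) = (tri s u : X) * (lt s u : X))
    (s t : M) (u : G) :
    tau s t * tri (mul s t) u = tri s (tri t u) * tau (lt s (tri t u)) (lt t u) := by
  have hl : (s : X) * t * u =
      ((tau s t * tri (mul s t) u : G) : X) * (lt (mul s t) u : X) := by
    rw [htau, mul_assoc, htl, Subgroup.coe_mul, mul_assoc]
  have hr : (s : X) * t * u =
      ((tri s (tri t u) * tau (lt s (tri t u)) (lt t u) : G) : X) *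
        (mul (lt s (tri t u)) (lt t u) : X) := by
    rw [mul_assoc, htl, ← mul_assoc, htl, mul_assoc, htau, Subgroup.coe_mul, mul_assoc]
  have hm := (hM ((s : X) * t * u)).unique ⟨_, hl⟩ ⟨_, hr⟩
  rw [hl, hm] at hr
  exact Subtype.ext (mul_right_cancel hr)

theorem stmt_17 (X : Type*) [Group X] (G : Subgroup X) (M : Set X)
    (h1 : (1 : X) ∈ M)
    (hM : ∀ x : X, ∃! s : M, ∃ g : G, x = (g : X) * (s : X))
    (tau : M → M → G) (mul : M → M → M)
    (htau : ∀ s t : M, (s : X) * (t : X) = (tau s t : X) * (mul s t : X))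
    (tri : M → G → G) (lt : M → G → M)
    (htl : ∀ (s : M) (u : G), (s : X) * (u : X) = (tri s u : X) * (lt s u : X))
: ∀ (s t : M) (u : G),
    tri (mul s t) u = tri s (tri t u) ↔
      tau (lt s (tri t u)) (lt t u)
        = (tri s (tri t u))⁻¹ * tau s t * tri s (tri t u) := by
  intro s t u
  have h := cocycle_mul_action_eq hM htau htl s t u
  rw [mul_assoc, eq_inv_mul_iff_mul_eq, ← h, mul_right_inj]
end

section
/- Suppose G is finite, M with the product · is a two-sided inverse property quasigroup (s^{-L}·(s·t) = t and (t·s)·s^{-L} = t for all s, t ∈ M), and for every s ∈ M the map u ↦ s▷u is a surjection of G onto G. If τ(s, t◁u) = τ(s,t) and τ(s◁(s^{-L}▷u), t) = u^{-1}τ(s,t)u hold for all s, t ∈ M and u ∈ G, then the condition τ(s◁(t▷u), t◁u) = (s▷(t▷u))^{-1} τ(s,t) (s▷(t▷u)) holds for all s, t ∈ M and u ∈ G. -/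
theorem stmt_18 (X : Type*) [Group X] (G : Subgroup X) (M : Set X)
    (h1 : (1 : X) ∈ M)
    (hM : ∀ x : X, ∃! s : M, ∃ g : G, x = (g : X) * (s : X))
    (tau : M → M → G) (mul : M → M → M)
    (htau : ∀ s t : M, (s : X) * (t : X) = (tau s t : X) * (mul s t : X))
    (tri : M → G → G) (lt : M → G → M)
    (htl : ∀ (s : M) (u : G), (s : X) * (u : X) = (tri s u : X) * (lt s u : X))
    (inv : M → M)
    (hinv : ∀ s : M, (s : X)⁻¹ = ((tau (inv s) s : G) : X)⁻¹ * ((inv s : M) : X))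
    (hfin : Finite G)
    (hIP : ∀ s t : M, mul (inv s) (mul s t) = t ∧ mul (mul t s) (inv s) = t)
    (hsurj : ∀ s : M, Function.Surjective (tri s))
    (hc1 : ∀ (s t : M) (u : G), tau s (lt t u) = tau s t)
    (hc2 : ∀ (s t : M) (u : G), tau (lt s (tri (inv s) u)) t = u⁻¹ * tau s t * u) :
    ∀ (s t : M) (u : G),
      tau (lt s (tri t u)) (lt t u)
        = (tri s (tri t u))⁻¹ * tau s t * tri s (tri t u) := by
  have mul_inv_self (s : M) : mul s (inv s) = ⟨1, h1⟩ := by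
    have one_mul_s : mul ⟨1, h1⟩ s = s := by
      refine (transversal_factorization_unique hM (g := tau ⟨1, h1⟩ s) (h := 1) ?_).2
      rw [← htau]
      simp
    have h := (hIP s ⟨1, h1⟩).2
    rwa [one_mul_s] at h
  have tri_tri_inv (s : M) (w : G) : tri s (tri (inv s) w) = w := by
    have e : ((tri s (tri (inv s) w) * tau (lt s (tri (inv s) w)) (lt (inv s) w) : G) : X) *
          (mul (lt s (tri (inv s) w)) (lt (inv s) w) : X) =
        ((tau s (inv s) * w : G) : X) * ((⟨1, h1⟩ : M) : X) := by
      rw [Subgroup.coe_mul, mul_assoc, ← htau, ← mul_assoc, ← htl, mul_assoc, ← htl,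
        ← mul_assoc, htau, mul_inv_self]
      simp
    have h := (transversal_factorization_unique hM e).1
    rw [hc1, hc2, mul_assoc, ← mul_assoc] at h
    exact mul_inv_eq_one.mp (mul_eq_right.mp h)
  intro s t u
  obtain ⟨w, hw⟩ := hsurj (inv s) (tri t u)
  rw [hc1, ← hw, hc2, tri_tri_inv]
end

section
/- Suppose that u^{-1}τ(s^{-L},s)u = τ(s^{-L}◁(s▷u), s◁u) holds for all s ∈ M and u ∈ G. Then for all s ∈ M and v ∈ G, s▷v = 1 if and only if v = 1. -/
theorem stmt_19 (X : Type*) [Group X] (G : Subgroup X) (M : Set X)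
    (h1 : (1 : X) ∈ M)
    (hM : ∀ x : X, ∃! s : M, ∃ g : G, x = (g : X) * (s : X))
    (tau : M → M → G) (mul : M → M → M)
    (htau : ∀ s t : M, (s : X) * (t : X) = (tau s t : X) * (mul s t : X))
    (tri : M → G → G) (lt : M → G → M)
    (htl : ∀ (s : M) (u : G), (s : X) * (u : X) = (tri s u : X) * (lt s u : X))
    (inv : M → M)
    (hinv : ∀ s : M, (s : X)⁻¹ = ((tau (inv s) s : G) : X)⁻¹ * ((inv s : M) : X))
    (hcond : ∀ (s : M) (u : G),
      u⁻¹ * tau (inv s) s * u = tau (lt (inv s) (tri s u)) (lt s u)) :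
    ∀ (s : M) (v : G), tri s v = 1 ↔ v = 1 := by
  have tri_one : ∀ s : M, tri s 1 = 1 := by
    intro s
    have h := htl s 1
    have hs : lt s 1 = s :=
      (hM s).unique ⟨tri s 1, by simpa using h⟩ ⟨1, by simp⟩
    rw [hs] at h
    exact Subtype.ext (by simpa using h)
  have tri_inv_tri : ∀ (s : M) (u : G), tri (inv s) (tri s u) = u := by
    intro s u
    have hts : ((inv s : M) : X) * (s : X) = (tau (inv s) s : G) := by
      have h := hinv s
      rw [eq_inv_mul_iff_mul_eq] at h
      rw [← h]
      group
    have hsu := htl s u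
    have htr := htl (inv s) (tri s u)
    have htm := htau (lt (inv s) (tri s u)) (lt s u)
    rw [← hcond s u] at htm
    set a := tau (inv s) s
    set m := mul (lt (inv s) (tri s u)) (lt s u)
    have key : (a : X) * u = (tri (inv s) (tri s u) * (u⁻¹ * a * u) : G) * (m : X) := by
      calc (a : X) * u = (inv s : M) * ((s : X) * u) := by rw [← hts, mul_assoc]
        _ = ((inv s : M) : X) * (tri s u : G) * (lt s u : M) := by rw [hsu, mul_assoc]
        _ = _ := by rw [htr, mul_assoc, htm, ← mul_assoc, ← Subgroup.coe_mul]
    have hm : m = ⟨1, h1⟩ :=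
      (hM ((a : X) * u)).unique ⟨_, key⟩ ⟨a * u, by simp⟩
    rw [hm] at key
    have hG : a * u = tri (inv s) (tri s u) * (u⁻¹ * a * u) :=
      Subtype.ext (by simpa using key)
    rw [eq_mul_inv_of_mul_eq hG.symm]
    group
  intro s v
  constructor
  · intro h
    rw [← tri_inv_tri s v, h, tri_one]
  · rintro rfl
    exact tri_one s
end
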